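/- If T : M_n(ℂ) → M_r(ℂ) is a linear map that is positive and trace preserving, then ‖T(A)‖_1 ≤ ‖A‖_1 for every A ∈ M_n(ℂ), i.e. ‖T‖_{1-1} = 1 (the value 1 is attained, e.g. at a density matrix). -/

import Mathlib

open scoped ENNReal ComplexOrder

/-- The singular values of a complex square matrix `A`, i.e. the (square roots of the)
eigenvalues of `Aᴴ * A`. -/
noncomputable def singularValues {n : ℕ} (A : Matrix (Fin n) (Fin n) ℂ) : Fin n → ℝ :=
  fun i => Real.sqrt ((Matrix.posSemidef_conjTranspose_mul_self A).isHermitian.eigenvalues i)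

/-- The Schatten `p`-norm `‖A‖_p = (tr |A|^p)^{1/p}`; for `p = ∞` it is the operator
(largest singular value) norm. -/
noncomputable def schattenNorm {n : ℕ} (p : ℝ≥0∞) (A : Matrix (Fin n) (Fin n) ℂ) : ℝ :=
  if p = ⊤ then ⨆ i, singularValues A i
  else (∑ i, singularValues A i ^ p.toReal) ^ (1 / p.toReal)

/-- A linear map between matrix algebras is positive if it maps positive semi-definite
matrices to positive semi-definite matrices. -/
def IsPositiveMatrixMap {n r : ℕ} (T : Matrix (Fin n) (Fin n) ℂ →ₗ[ℂ] Matrix (Fin r) (Fin r) ℂ) :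
    Prop :=
  ∀ A : Matrix (Fin n) (Fin n) ℂ, A.PosSemidef → (T A).PosSemidef

/-- A linear map between matrix algebras is trace preserving if `tr T(A) = tr A` for all `A`. -/
def IsTracePreservingMap {n r : ℕ}
    (T : Matrix (Fin n) (Fin n) ℂ →ₗ[ℂ] Matrix (Fin r) (Fin r) ℂ) : Prop :=
  ∀ A : Matrix (Fin n) (Fin n) ℂ, (T A).trace = A.trace

open Matrix in
open scoped Matrix.Norms.L2Operator in
lemma aux_spectral {r : ℕ} (U : Matrix (Fin r) (Fin r) ℂ) (hU : U ∈ unitary (Matrix (Fin r) (Fin r) ℂ)) :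
    ∃ (s : Finset ℂ) (P : ℂ → Matrix (Fin r) (Fin r) ℂ),
      (∀ z ∈ s, ‖z‖ = 1) ∧ (∀ z, (P z)ᴴ * P z = P z) ∧ ∑ z ∈ s, P z = 1 ∧ ∑ z ∈ s, z • P z = U := by
  classical
  have hfin : (spectrum ℂ U).Finite := Matrix.finite_spectrum U
  have hn : IsStarNormal U := ⟨by
    rw [Unitary.mem_iff] at hU
    rw [commute_iff_eq, hU.1, hU.2]⟩
  have hc : ∀ f : ℂ → ℂ, ContinuousOn f (spectrum ℂ U) := fun f => hfin.continuousOn f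
  refine ⟨hfin.toFinset, fun z => cfc (fun x => if x = z then (1 : ℂ) else 0) U, ?_, ?_, ?_, ?_⟩
  · intro z hz
    have := spectrum.subset_circle_of_unitary hU (hfin.mem_toFinset.1 hz)
    simpa using this
  · intro z
    rw [← Matrix.star_eq_conjTranspose, ← cfc_star, ← cfc_mul _ _ _ (hc _) (hc _)]
    congr 1
    ext x
    split_ifs <;> simp
  · rw [← cfc_sum _ _ _ (fun _ _ => hc _), ← cfc_one ℂ U hn]
    apply cfc_congr
    intro x hx
    simp [hx]
  · have : ∀ z : ℂ, z • cfc (fun x => if x = z then (1 : ℂ) else 0) U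
        = cfc (fun x => z * (if x = z then (1 : ℂ) else 0)) U := fun z =>
      (cfc_const_mul z _ U (hc _)).symm
    simp_rw [this]
    rw [← cfc_sum _ _ _ (fun _ _ => hc _)]
    conv_rhs => rw [← cfc_id ℂ U hn]
    apply cfc_congr
    intro x hx
    simp [hx]

open Matrix in
lemma aux_svd {n : ℕ} (A : Matrix (Fin n) (Fin n) ℂ) :
    ∃ W V : Matrix (Fin n) (Fin n) ℂ, Wᴴ * W = 1 ∧ Vᴴ * V = 1 ∧
      A = W * diagonal (fun i => (singularValues A i : ℂ)) * Vᴴ := by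
  set hH := (Matrix.posSemidef_conjTranspose_mul_self A).isHermitian with hHdef
  set v := hH.eigenvectorBasis with hv
  set s := singularValues A with hs
  have hs2 : ∀ i, s i ^ 2 = hH.eigenvalues i := fun i =>
    Real.sq_sqrt ((Matrix.posSemidef_conjTranspose_mul_self A).eigenvalues_nonneg i)
  have key : ∀ i j, inner ℂ (WithLp.toLp 2 (A *ᵥ (v i))) (WithLp.toLp 2 (A *ᵥ (v j)))
      = ((s j : ℂ)) ^ 2 * (if i = j then 1 else 0) := by
    intro i j
    have h1 := hH.mulVec_eigenvectorBasis j
    have h2 := orthonormal_iff_ite.1 v.orthonormal i j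
    rw [← h2]
    rw [EuclideanSpace.inner_eq_star_dotProduct, EuclideanSpace.inner_eq_star_dotProduct]
    simp only [star_mulVec]
    rw [dotProduct_comm, ← dotProduct_mulVec, mulVec_mulVec, h1]
    rw [← hs2]
    simp [dotProduct_comm, hv]
  let u0 : Fin n → EuclideanSpace ℂ (Fin n) := fun i =>
    ((s i : ℂ)⁻¹) • WithLp.toLp 2 (A *ᵥ (v i))
  have hon : Orthonormal ℂ (({i | s i ≠ 0} : Set (Fin n)).domRestrict u0) := by
    rw [orthonormal_iff_ite]
    rintro ⟨i, hi⟩ ⟨j, hj⟩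
    have hi' : (s i : ℂ) ≠ 0 := by exact_mod_cast hi
    change inner ℂ (u0 i) (u0 j) = _
    simp only [u0, inner_smul_left, inner_smul_right, key, Subtype.mk.injEq]
    by_cases hij : i = j
    · subst hij
      simp
      field_simp
    · simp [hij]
  obtain ⟨b, hb⟩ := hon.exists_orthonormalBasis_extension_of_card_eq (by simp)
  have hAv : ∀ i, A *ᵥ (v i) = (s i : ℂ) • (b i : Fin n → ℂ) := by
    intro i
    by_cases hi : s i = 0
    · have := key i i
      rw [hi] at this
      simp at this
      rw [this, hi]; simp
    · have hi' : (s i : ℂ) ≠ 0 := by exact_mod_cast hi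
      rw [hb i hi]
      simp [u0, smul_smul, hi']
  have hun : ∀ c : OrthonormalBasis (Fin n) ℂ (EuclideanSpace ℂ (Fin n)),
      (Matrix.of fun i j => c j i)ᴴ * (Matrix.of fun i j => c j i) = 1 := by
    intro c
    ext i j
    have := orthonormal_iff_ite.1 c.orthonormal i j
    rw [EuclideanSpace.inner_eq_star_dotProduct, dotProduct_comm] at this
    rw [Matrix.one_apply, ← this]
    simp [Matrix.mul_apply, dotProduct]
  refine ⟨Matrix.of fun i j => b j i, Matrix.of fun i j => v j i, hun b, hun v, ?_⟩
  have hV := mul_eq_one_comm.1 (hun v)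
  have hAV : A * (Matrix.of fun i j => v j i)
      = (Matrix.of fun i j => b j i) * diagonal (fun i => (s i : ℂ)) := by
    ext i j
    have := congrFun (hAv j) i
    rw [Matrix.mul_diagonal]
    simp only [Matrix.mul_apply, mulVec, dotProduct, Pi.smul_apply, smul_eq_mul] at this ⊢
    simp only [of_apply]
    rw [this, mul_comm]
  rw [← hAV, mul_assoc, hV, mul_one]

lemma aux_norm {n : ℕ} (A : Matrix (Fin n) (Fin n) ℂ) : schattenNorm 1 A = ∑ i, singularValues A i := by
  simp [schattenNorm]

open Matrix in
lemma aux_dom {n : ℕ} (A : Matrix (Fin n) (Fin n) ℂ) :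
    ∃ S : Matrix (Fin n) (Fin n) ℂ, S.PosSemidef ∧ S.trace = 2 * (schattenNorm 1 A : ℂ) ∧
      ∀ z : ℂ, ‖z‖ = 1 → (S - z • A - star z • Aᴴ).PosSemidef := by
  obtain ⟨W, V, hW, hV, hA⟩ := aux_svd A
  set D : Matrix (Fin n) (Fin n) ℂ := diagonal (fun i => (singularValues A i : ℂ)) with hD
  have hDp : D.PosSemidef := by
    rw [hD, posSemidef_diagonal_iff]
    intro i
    exact Complex.zero_le_real.2 (Real.sqrt_nonneg _)
  have hDt : D.trace = (schattenNorm 1 A : ℂ) := by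
    rw [aux_norm, hD, trace_diagonal]; push_cast; rfl
  refine ⟨W * D * Wᴴ + V * D * Vᴴ, ?_, ?_, ?_⟩
  · exact (hDp.mul_mul_conjTranspose_same W).add (hDp.mul_mul_conjTranspose_same V)
  · rw [trace_add, trace_mul_comm, ← mul_assoc, hW, trace_mul_comm (V * D), ← mul_assoc, hV,
      one_mul, hDt]; ring
  · intro z hz
    have hzz : z * star z = 1 := by
      rw [Complex.star_def, Complex.mul_conj, Complex.normSq_eq_norm_sq, hz]; simp
    have h := hDp.mul_mul_conjTranspose_same (z • W - V)
    convert h using 1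
    have hAH : Aᴴ = V * D * Wᴴ := by
      conv_lhs => rw [hA]
      simp [conjTranspose_mul, hDp.isHermitian.eq, mul_assoc]
    rw [hAH]
    conv_lhs => rw [hA]
    simp only [conjTranspose_sub, conjTranspose_smul, sub_mul, mul_sub, smul_mul_assoc,
      mul_smul_comm, smul_sub, smul_smul, hzz, mul_comm (star z) z, one_smul]
    abel

open Matrix in
lemma aux_trace_le {n : ℕ} (A : Matrix (Fin n) (Fin n) ℂ) : A.trace.re ≤ schattenNorm 1 A := by
  obtain ⟨S, -, hS, h⟩ := aux_dom A
  have := (h 1 (by simp)).trace_nonneg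
  have := (Complex.le_def.1 this).1
  simp [hS, trace_conjTranspose] at this
  linarith

open Matrix in
lemma aux_herm {n r : ℕ} (T : Matrix (Fin n) (Fin n) ℂ →ₗ[ℂ] Matrix (Fin r) (Fin r) ℂ)
    (hTpos : IsPositiveMatrixMap T) (A : Matrix (Fin n) (Fin n) ℂ) : T Aᴴ = (T A)ᴴ := by
  obtain ⟨S, hS0, -, h⟩ := aux_dom A
  have h0 := (hTpos _ hS0).isHermitian.eq
  have h1 := (hTpos _ (h 1 (by simp))).isHermitian.eq
  have h2 := (hTpos _ (h Complex.I (by simp))).isHermitian.eq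
  ext i j
  have e0 := congrFun (congrFun h0 i) j
  have e1 := congrFun (congrFun h1 i) j
  have e2 := congrFun (congrFun h2 i) j
  simp at e0 e1 e2
  simp only [conjTranspose_apply, Complex.star_def]
  rw [e0] at e1 e2
  have hI : Complex.I ≠ 0 := Complex.I_ne_zero
  have e3 : Complex.I * ((starRingEnd ℂ) (T A j i) - (starRingEnd ℂ) (T Aᴴ j i))
    = Complex.I * (T Aᴴ i j - T A i j) := by linear_combination e2
  have e4 := mul_left_cancel₀ hI e3
  linear_combination (-1/2 : ℂ) * e4 + (1/2 : ℂ) * e1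

open Matrix in
lemma aux_contr {n r : ℕ} (T : Matrix (Fin n) (Fin n) ℂ →ₗ[ℂ] Matrix (Fin r) (Fin r) ℂ)
    (hTpos : IsPositiveMatrixMap T) (hTtr : IsTracePreservingMap T)
    (A : Matrix (Fin n) (Fin n) ℂ) : schattenNorm 1 (T A) ≤ schattenNorm 1 A := by
  obtain ⟨S, hS0, hSt, hS⟩ := aux_dom A
  obtain ⟨W, V, hW, hV, hB⟩ := aux_svd (T A)
  have hW' := mul_eq_one_comm.1 hW
  have hV' := mul_eq_one_comm.1 hV
  have hU : V * Wᴴ ∈ unitary (Matrix (Fin r) (Fin r) ℂ) := by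
    rw [Unitary.mem_iff]
    simp only [star_eq_conjTranspose, conjTranspose_mul, conjTranspose_conjTranspose]
    constructor
    · rw [mul_assoc, ← mul_assoc Vᴴ, hV, one_mul, hW']
    · rw [mul_assoc, ← mul_assoc Wᴴ, hW, one_mul, hV']
  have htr : (V * Wᴴ * T A).trace = (schattenNorm 1 (T A) : ℂ) := by
    conv_lhs => rw [hB]
    rw [mul_assoc, trace_mul_comm]
    simp only [mul_assoc, hV, mul_one]
    rw [← mul_assoc, hW, one_mul, trace_diagonal, aux_norm]
    push_cast; rfl
  obtain ⟨s, P, hs, hP, hP1, hPU⟩ := aux_spectral _ hU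
  have hz : ∀ z ∈ s, 2 * (z • P z * T A).trace.re ≤ (P z * T S).trace.re := by
    intro z hz
    have h1 := ((hTpos _ (hS z (hs z hz))).mul_mul_conjTranspose_same (P z)).trace_nonneg
    rw [trace_mul_comm, ← mul_assoc, hP] at h1
    have h2 := (Complex.le_def.1 h1).1
    have hPH : (P z)ᴴ = P z := by
      rw [← hP z]; simp
    have h3 : (P z * (T A)ᴴ).trace = star (P z * T A).trace := by
      rw [← trace_conjTranspose, conjTranspose_mul, hPH, trace_mul_comm]
    simp only [map_sub, map_smul, aux_herm T hTpos, mul_sub, trace_sub, mul_smul_comm, trace_smul,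
      h3, smul_mul_assoc] at h2 ⊢
    simp at h2 ⊢
    linarith
  have hsum := Finset.sum_le_sum hz
  rw [← Finset.mul_sum, ← Complex.re_sum, ← Complex.re_sum, ← trace_sum, ← trace_sum,
    ← Finset.sum_mul, ← Finset.sum_mul, hP1, hPU, one_mul, hTtr, htr, hSt] at hsum
  simp at hsum
  linarith

/-- If `T : M_n(ℂ) → M_r(ℂ)` is positive and trace preserving then `‖T(A)‖₁ ≤ ‖A‖₁` for all
`A`, i.e. `‖T‖_{1-1} = 1`: the value `1` is attained, e.g. at a density matrix. -/
theorem traceNorm_contractive_of_posMap_tracePreserving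
    (n r : ℕ) (hn : 0 < n)
    (T : Matrix (Fin n) (Fin n) ℂ →ₗ[ℂ] Matrix (Fin r) (Fin r) ℂ)
    (hTpos : IsPositiveMatrixMap T) (hTtr : IsTracePreservingMap T) :
    (∀ A : Matrix (Fin n) (Fin n) ℂ, schattenNorm 1 (T A) ≤ schattenNorm 1 A) ∧
      ∃ A : Matrix (Fin n) (Fin n) ℂ, A.PosSemidef ∧ A.trace = 1 ∧
        schattenNorm 1 A = 1 ∧ schattenNorm 1 (T A) = schattenNorm 1 A := by
  refine ⟨aux_contr T hTpos hTtr, ?_⟩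
  set E : Matrix (Fin n) (Fin n) ℂ := Matrix.single ⟨0, hn⟩ ⟨0, hn⟩ 1 with hE
  have hEE : E.conjTranspose * E = E := by
    rw [hE, Matrix.conjTranspose_single]; simp
  have hEt : E.trace = 1 := by rw [hE, Matrix.trace_single_eq_same]
  have hEp : E.PosSemidef := hEE ▸ Matrix.posSemidef_conjTranspose_mul_self E
  have hsv : ∀ i, singularValues E i
      = (Matrix.posSemidef_conjTranspose_mul_self E).isHermitian.eigenvalues i := by
    intro i
    have h1 := (Matrix.posSemidef_conjTranspose_mul_self E).isHermitian.mulVec_eigenvectorBasis i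
    set e := (Matrix.posSemidef_conjTranspose_mul_self E).isHermitian.eigenvalues i with he
    set w := (Matrix.posSemidef_conjTranspose_mul_self E).isHermitian.eigenvectorBasis with hw
    have hne : (w i : Fin n → ℂ) ≠ 0 := fun h => w.orthonormal.ne_zero i (by ext j; simp [h])
    have h2 : (e * e) • (w i : Fin n → ℂ) = e • (w i : Fin n → ℂ) := by
      rw [mul_smul, ← h1, ← Matrix.mulVec_smul, ← h1, Matrix.mulVec_mulVec]
      rw [hEE, show E * E = E by rw [hE]; simp]
    have h3 : e * e = e := smul_left_injective ℝ hne h2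
    change Real.sqrt e = e
    have h0 : 0 ≤ e := (Matrix.posSemidef_conjTranspose_mul_self E).eigenvalues_nonneg i
    rw [Real.sqrt_eq_iff_mul_self_eq h0 h0, h3]
  have hEn : schattenNorm 1 E = 1 := by
    rw [aux_norm, Finset.sum_congr rfl (fun i _ => hsv i)]
    have := (Matrix.posSemidef_conjTranspose_mul_self E).isHermitian.trace_eq_sum_eigenvalues
    have h1 : (E.conjTranspose * E).trace = 1 := by rw [hEE, hEt]
    rw [h1] at this
    have h2 := congrArg Complex.re this
    simp at h2
    exact h2.symm
  refine ⟨E, hEp, hEt, hEn, le_antisymm (aux_contr T hTpos hTtr E) ?_⟩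
  have := aux_trace_le (T E)
  rw [hTtr, hEt] at this
  rw [hEn]
  simpa using this
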